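/- For every finite vertex set L ⊆ V and every x ∈ L: Σ_{x'∈L} e_L(x') · P_{x'}[τ_{{x}} < ∞] = cap({x}). -/

import Mathlib

open MeasureTheory Filter

section Setup

variable {V : Type*} [MeasurableSpace V]

/-- Total weight at a vertex: `a_x = Σ_{z∼x} a_{x,z}`. -/
noncomputable def aTot (G : SimpleGraph V) [G.LocallyFinite] (a : V → V → ℝ) (x : V) : ℝ :=
  ∑ z ∈ G.neighborFinset x, a x z

open Classical in
/-- Transition probabilities of the weighted random walk:
`p(x,y) = a_{x,y}/a_x` for edges and `0` otherwise. -/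
noncomputable def step (G : SimpleGraph V) [G.LocallyFinite] (a : V → V → ℝ) (x y : V) : ℝ :=
  if G.Adj x y then a x y / aTot G a x else 0

/-- The event `{τ_K^+ = ∞}`: the walk never returns to `K` at a time `n ≥ 1`. -/
def noReturn (K : Set V) : Set (ℕ → V) := {w | ∀ n ≥ 1, w n ∉ K}

/-- The event `{τ_K < ∞}`: the walk hits `K`. -/
def hits (K : Set V) : Set (ℕ → V) := {w | ∃ n, w n ∈ K}

/-- The event `{τ_K < ∞ and X_{τ_K} = y}`: the walk hits `K`, entering it at `y`. -/
def hitsAt (K : Set V) (y : V) : Set (ℕ → V) :=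
  {w | (∃ n, w n ∈ K) ∧ w (sInf {n | w n ∈ K}) = y}

/-- The event `{λ_K < ∞ and X_{λ_K} = y}`: the walk visits `K`, finitely often,
and its last visit to `K` is at `y`. -/
def lastVisitAt (K : Set V) (y : V) : Set (ℕ → V) :=
  {w | (∃ n, w n ∈ K) ∧ {n | w n ∈ K}.Finite ∧ w (sSup {n | w n ∈ K}) = y}

open Classical in
/-- The equilibrium measure of a finite vertex set `K`:
`e_K(x) = a_x · P_x[τ_K^+ = ∞]` for `x ∈ K`, and `0` otherwise. -/
noncomputable def equil (G : SimpleGraph V) [G.LocallyFinite] (a : V → V → ℝ)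
    (P : V → Measure (ℕ → V)) (K : Finset V) (x : V) : ℝ :=
  if x ∈ K then aTot G a x * ((P x) (noReturn (K : Set V))).toReal else 0

/-- The capacity of a finite vertex set `K`: `cap(K) = Σ_{x∈K} e_K(x)`. -/
noncomputable def capa (G : SimpleGraph V) [G.LocallyFinite] (a : V → V → ℝ)
    (P : V → Measure (ℕ → V)) (K : Finset V) : ℝ :=
  ∑ x ∈ K, equil G a P K x

/-- The harmonic measure of a nonempty finite vertex set `K`: `harm_K = e_K / cap(K)`. -/
noncomputable def harm (G : SimpleGraph V) [G.LocallyFinite] (a : V → V → ℝ)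
    (P : V → Measure (ℕ → V)) (K : Finset V) (x : V) : ℝ :=
  equil G a P K x / capa G a P K

end Setup

open scoped ENNReal

section PathSpace

variable {V : Type*}

/-- The first `n + 1` vertices of a path. -/
def pathPrefix (n : ℕ) (w : ℕ → V) : Fin (n + 1) → V := fun i => w i

/-- Extend a finite path to an infinite one by staying at its last vertex. -/
def extendPath (n : ℕ) (c : Fin (n + 1) → V) : ℕ → V :=
  fun i => c ⟨min i n, by omega⟩

/-- The path seen from time `n` on. -/
def shiftPath (n : ℕ) (w : ℕ → V) : ℕ → V := fun i => w (n + i)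

lemma pathPrefix_preimage_singleton (n : ℕ) (c : Fin (n + 1) → V) :
    pathPrefix n ⁻¹' {c} = {w | ∀ i ≤ n, w i = extendPath n c i} := by
  ext w
  simp only [Set.mem_preimage, Set.mem_singleton_iff, Set.mem_ofPred_eq]
  constructor
  · rintro rfl i hi
    simp [extendPath, pathPrefix, hi]
  · intro h
    funext i
    have hi : (i : ℕ) ≤ n := by omega
    simpa [extendPath, pathPrefix, hi] using h i hi

lemma prod_step_reverse (A : V → ℝ≥0∞) (p : V → V → ℝ≥0∞)
    (hrev : ∀ u v, A u * p u v = A v * p v u) (c : ℕ → V) (n : ℕ) :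
    A (c 0) * ∏ i ∈ Finset.range n, p (c i) (c (i + 1)) =
      A (c n) * ∏ i ∈ Finset.range n, p (c (n - i)) (c (n - (i + 1))) := by
  have h : A (c 0) * ∏ i ∈ Finset.range n, p (c i) (c (i + 1)) =
      A (c n) * ∏ i ∈ Finset.range n, p (c (i + 1)) (c i) := by
    induction n with
    | zero => simp
    | succ n ih =>
      rw [Finset.prod_range_succ, ← mul_assoc, ih, Finset.prod_range_succ, mul_right_comm,
        hrev, mul_right_comm, mul_assoc]
  rw [h, ← Finset.prod_range_reflect]
  congr 1
  refine Finset.prod_congr rfl fun i hi => ?_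
  have hi := Finset.mem_range.1 hi
  rw [show n - 1 - i + 1 = n - i by omega, show n - 1 - i = n - (i + 1) by omega]

variable [MeasurableSpace V]

@[fun_prop]
lemma measurable_shiftPath (n : ℕ) : Measurable (shiftPath (V := V) n) := by
  unfold shiftPath; fun_prop

variable [DiscreteMeasurableSpace V]

lemma measurableSet_pathPrefix_preimage [Countable V] (n : ℕ) (S : Set (Fin (n + 1) → V)) :
    MeasurableSet (pathPrefix n ⁻¹' S) := by
  have h : Measurable (pathPrefix (V := V) n) := by unfold pathPrefix; fun_prop
  exact h (Set.to_countable S).measurableSet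

lemma measurableSet_noReturn (K : Set V) : MeasurableSet (noReturn K) := by
  have : noReturn K = ⋂ n : ℕ, ⋂ (_ : n ≥ 1), (fun w : ℕ → V => w n) ⁻¹' Kᶜ := by
    ext w; simp [noReturn]
  rw [this]
  exact MeasurableSet.iInter fun n => MeasurableSet.iInter fun _ =>
    measurable_pi_apply n (MeasurableSet.of_discrete)

variable [Countable V]

lemma tsum_measure_pathPrefix (μ : Measure (ℕ → V)) (n : ℕ) (S : Set (Fin (n + 1) → V)) :
    ∑' c : S, μ (pathPrefix n ⁻¹' {(c : Fin (n + 1) → V)}) = μ (pathPrefix n ⁻¹' S) :=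
  tsum_measure_preimage_singleton (Set.to_countable S)
    fun _ _ => measurableSet_pathPrefix_preimage n _

/-- A finite measure on path space is determined by the cylinder sets. -/
lemma measure_ext_of_cylinders (μ ν : Measure (ℕ → V)) [IsFiniteMeasure μ]
    (h : ∀ (n : ℕ) (c : ℕ → V), μ {w | ∀ i ≤ n, w i = c i} = ν {w | ∀ i ≤ n, w i = c i}) :
    μ = ν := by
  have hpre (n : ℕ) (S : Set (Fin (n + 1) → V)) :
      μ (pathPrefix n ⁻¹' S) = ν (pathPrefix n ⁻¹' S) := by
    rw [← tsum_measure_pathPrefix, ← tsum_measure_pathPrefix]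
    simp_rw [pathPrefix_preimage_singleton, h]
  refine ext_of_generate_finite {s | ∃ n, ∃ S : Set (Fin (n + 1) → V), s = pathPrefix n ⁻¹' S}
    ?_ ?_ ?_ ?_
  · apply le_antisymm
    · refine iSup_le fun i => ?_
      rintro _ ⟨t, -, rfl⟩
      exact MeasurableSpace.measurableSet_generateFrom
        ⟨i, {c | c (Fin.last i) ∈ t}, by ext w; simp [pathPrefix]⟩
    · apply MeasurableSpace.generateFrom_le
      rintro _ ⟨n, S, rfl⟩
      exact measurableSet_pathPrefix_preimage n S
  · rintro _ ⟨n, S, rfl⟩ _ ⟨m, T, rfl⟩ -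
    refine ⟨max n m, {c | (fun i : Fin (n + 1) => c ⟨i, by omega⟩) ∈ S ∧
      (fun i : Fin (m + 1) => c ⟨i, by omega⟩) ∈ T}, rfl⟩
  · rintro _ ⟨n, S, rfl⟩
    exact hpre n S
  · simpa using hpre 0 Set.univ

end PathSpace

section Walk

variable {V : Type*} [Countable V] [MeasurableSpace V] [DiscreteMeasurableSpace V]
  {p : V → V → ℝ≥0∞} {P : V → Measure (ℕ → V)}

open Classical in
lemma walk_ae_start (hprob : ∀ x, IsProbabilityMeasure (P x))
    (hP : ∀ (x : V) (n : ℕ) (c : ℕ → V), P x {w | ∀ i ≤ n, w i = c i} =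
      (if c 0 = x then 1 else 0) * ∏ i ∈ Finset.range n, p (c i) (c (i + 1))) (x : V) :
    ∀ᵐ w ∂P x, w 0 = x := by
  have := hprob x
  have h := hP x 0 fun _ => x
  simp only [nonpos_iff_eq_zero, forall_eq, if_true, Finset.range_zero, Finset.prod_empty,
    mul_one] at h
  exact (prob_compl_eq_zero_iff
    (measurable_pi_apply (X := fun _ : ℕ => V) 0 (measurableSet_singleton x))).2 h

open Classical in
/-- The Markov property at a fixed time. -/
lemma walk_markov (hprob : ∀ x, IsProbabilityMeasure (P x))
    (hP : ∀ (x : V) (n : ℕ) (c : ℕ → V), P x {w | ∀ i ≤ n, w i = c i} =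
      (if c 0 = x then 1 else 0) * ∏ i ∈ Finset.range n, p (c i) (c (i + 1)))
    (x y : V) (n : ℕ) (S : Set (Fin (n + 1) → V)) (hS : ∀ c ∈ S, c (Fin.last n) = y)
    {B : Set (ℕ → V)} (hB : MeasurableSet B) :
    P x (pathPrefix n ⁻¹' S ∩ shiftPath n ⁻¹' B) = P x (pathPrefix n ⁻¹' S) * P y B := by
  have := hprob x
  have key (c : Fin (n + 1) → V) (hc : c (Fin.last n) = y) :
      ((P x).restrict (pathPrefix n ⁻¹' {c})).map (shiftPath n) =
        P x (pathPrefix n ⁻¹' {c}) • P y := by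
    refine measure_ext_of_cylinders _ _ fun m d => ?_
    have hmeas : MeasurableSet {w : ℕ → V | ∀ i ≤ m, w i = d i} := by
      have : {w : ℕ → V | ∀ i ≤ m, w i = d i} =
          pathPrefix m ⁻¹' {fun i : Fin (m + 1) => d i} := by
        rw [pathPrefix_preimage_singleton]
        ext w
        refine forall₂_congr fun i hi => ?_
        simp [extendPath, hi]
      rw [this]
      exact measurableSet_pathPrefix_preimage m _
    rw [Measure.map_apply (measurable_shiftPath n) hmeas,
      Measure.restrict_apply (measurable_shiftPath n hmeas), Measure.smul_apply, smul_eq_mul,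
      pathPrefix_preimage_singleton, hP y, hP x n]
    have hcn : extendPath n c n = y := by simpa [extendPath, Fin.last] using hc
    by_cases hd : d 0 = y
    · have hset : shiftPath n ⁻¹' {w | ∀ i ≤ m, w i = d i} ∩
          {w | ∀ i ≤ n, w i = extendPath n c i} =
          {w | ∀ i ≤ n + m, w i = if i ≤ n then extendPath n c i else d (i - n)} := by
        ext w
        simp only [Set.mem_inter_iff, Set.mem_preimage, Set.mem_ofPred_eq, shiftPath]
        constructor
        · rintro ⟨h1, h2⟩ i hi
          split_ifs with hin
          · exact h2 i hin
          · simpa [show n + (i - n) = i by omega] using h1 (i - n) (by omega)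
        · intro h
          refine ⟨fun i hi => ?_, fun i hi => by simpa [hi] using h i (by omega)⟩
          have := h (n + i) (by omega)
          rcases Nat.eq_zero_or_pos i with rfl | hi0
          · simpa [hcn, hd] using this
          · simpa [show ¬ n + i ≤ n by omega] using this
      rw [hset, hP, Finset.prod_range_add]
      simp only [Nat.zero_le, if_true, hd, one_mul, mul_assoc]
      congr 2
      · refine Finset.prod_congr rfl fun i hi => ?_
        have hi := Finset.mem_range.1 hi
        rw [if_pos hi.le, if_pos (by omega)]
      · refine Finset.prod_congr rfl fun i hi => ?_
        rw [if_neg (show ¬ n + i + 1 ≤ n by omega), show n + i + 1 - n = i + 1 by omega]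
        rcases Nat.eq_zero_or_pos i with rfl | hi0
        · simp [hcn, hd]
        · rw [if_neg (by omega), show n + i - n = i by omega]
    · have hset : shiftPath n ⁻¹' {w | ∀ i ≤ m, w i = d i} ∩
          {w | ∀ i ≤ n, w i = extendPath n c i} = ∅ := by
        refine Set.eq_empty_of_forall_notMem fun w hw => hd ?_
        have h0 : w (n + 0) = d 0 := hw.1 0 (Nat.zero_le m)
        rw [← h0, ← hcn]
        exact hw.2 n le_rfl
      rw [hset]
      simp [hd]
  rw [← Measure.restrict_apply' (measurable_shiftPath n hB), ← tsum_measure_pathPrefix,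
    ← tsum_measure_pathPrefix, ← ENNReal.tsum_mul_right]
  refine tsum_congr fun c => ?_
  have := congrArg (fun μ => μ B) (key c (hS c c.2))
  simp only [Measure.map_apply (measurable_shiftPath n) hB,
    Measure.restrict_apply (measurable_shiftPath n hB), Measure.smul_apply, smul_eq_mul] at this
  rw [Measure.restrict_apply' (measurable_shiftPath n hB), Set.inter_comm, this]

/-- Finite paths of length `n` from `x` to `y` that do not come back to `x`. -/
def escapePaths (x y : V) (n : ℕ) : Set (Fin (n + 1) → V) :=
  {c | c 0 = x ∧ c (Fin.last n) = y ∧ ∀ i, i ≠ 0 → c i ≠ x}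

/-- Finite paths of length `n` from `y` that reach `x` for the first time at their end. -/
def firstHitPaths (y x : V) (n : ℕ) : Set (Fin (n + 1) → V) :=
  {c | c 0 = y ∧ c (Fin.last n) = x ∧ ∀ i, i ≠ Fin.last n → c i ≠ x}

open Classical in
/-- Time reversal of a reversible walk. -/
lemma walk_reverse (hP : ∀ (x : V) (n : ℕ) (c : ℕ → V), P x {w | ∀ i ≤ n, w i = c i} =
      (if c 0 = x then 1 else 0) * ∏ i ∈ Finset.range n, p (c i) (c (i + 1)))
    (A : V → ℝ≥0∞) (hrev : ∀ u v, A u * p u v = A v * p v u) (x y : V) (n : ℕ) :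
    A x * P x (pathPrefix n ⁻¹' escapePaths x y n) =
      A y * P y (pathPrefix n ⁻¹' firstHitPaths y x n) := by
  rw [← tsum_measure_pathPrefix, ← tsum_measure_pathPrefix, ← ENNReal.tsum_mul_left,
    ← ENNReal.tsum_mul_left]
  let e : escapePaths x y n ≃ firstHitPaths y x n :=
    (Equiv.arrowCongr Fin.revPerm (Equiv.refl V)).subtypeEquiv fun c => by
      simp only [escapePaths, firstHitPaths, Set.mem_ofPred_eq, Equiv.arrowCongr_apply,
        Function.comp_apply, Equiv.refl_apply, Fin.revPerm_symm, Fin.revPerm_apply,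
        Fin.rev_zero, Fin.rev_last]
      constructor
      · rintro ⟨h0, h1, h2⟩
        exact ⟨h1, h0, fun i hi => h2 _ fun h => hi (by rw [← Fin.rev_rev i, h, Fin.rev_zero])⟩
      · rintro ⟨h0, h1, h2⟩
        refine ⟨h1, h0, fun i hi => ?_⟩
        rw [← Fin.rev_rev i]
        exact h2 _ fun h => hi (by rw [← Fin.rev_rev i, h, Fin.rev_last])
  rw [← e.tsum_eq]
  refine tsum_congr fun c => ?_
  have he (i : ℕ) : extendPath n (e c : Fin (n + 1) → V) i = extendPath n c (n - i) := by
    change (c : Fin (n + 1) → V) (Fin.rev _) = (c : Fin (n + 1) → V) _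
    refine congrArg _ (Fin.ext ?_)
    simp only [Fin.val_rev]
    omega
  have h0 : extendPath n (c : Fin (n + 1) → V) 0 = x := by
    simpa [extendPath] using c.2.1
  have hn : extendPath n (c : Fin (n + 1) → V) n = y := by
    simpa [extendPath, Fin.last] using c.2.2.1
  rw [pathPrefix_preimage_singleton, pathPrefix_preimage_singleton, hP, hP]
  simp only [he, Nat.sub_zero, h0, hn, if_true, one_mul]
  have := prod_step_reverse A p hrev (extendPath n c) n
  rwa [h0, hn] at this

open Classical in
/-- Decomposition of the hitting event according to the hitting time. -/
lemma walk_hits_eq_tsum (hprob : ∀ x, IsProbabilityMeasure (P x))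
    (hP : ∀ (x : V) (n : ℕ) (c : ℕ → V), P x {w | ∀ i ≤ n, w i = c i} =
      (if c 0 = x then 1 else 0) * ∏ i ∈ Finset.range n, p (c i) (c (i + 1))) (x y : V) :
    P y (hits {x}) = ∑' n, P y (pathPrefix n ⁻¹' firstHitPaths y x n) := by
  have hmem (n : ℕ) (w : ℕ → V) : w ∈ pathPrefix n ⁻¹' firstHitPaths y x n ↔
      w 0 = y ∧ w n = x ∧ ∀ i < n, w i ≠ x := by
    simp only [firstHitPaths, pathPrefix, Set.mem_preimage, Set.mem_ofPred_eq, Fin.val_zero,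
      Fin.val_last]
    refine and_congr_right fun _ => and_congr_right fun _ => ⟨fun h i hi => ?_, fun h i hi => ?_⟩
    · exact h ⟨i, by omega⟩ (by simp [Fin.ext_iff]; omega)
    · exact h i (by have := Fin.val_ne_of_ne hi; simp at this; omega)
  rw [← measure_iUnion _ fun n => measurableSet_pathPrefix_preimage n _]
  · refine measure_congr ?_
    filter_upwards [walk_ae_start hprob hP y] with w hw
    refine propext (?_ : w ∈ hits {x} ↔ w ∈ ⋃ n, pathPrefix n ⁻¹' firstHitPaths y x n)
    simp only [Set.mem_iUnion, hmem, hits, Set.mem_ofPred_eq, Set.mem_singleton_iff]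
    constructor
    · intro h
      exact ⟨Nat.find h, hw, Nat.find_spec h, fun i hi => Nat.find_min h hi⟩
    · rintro ⟨n, -, h, -⟩
      exact ⟨n, h⟩
  · intro n m hnm
    refine Set.disjoint_left.2 fun w h1 h2 => ?_
    rw [hmem] at h1 h2
    rcases hnm.lt_or_gt with h | h
    · exact h2.2.2 n h h1.2.1
    · exact h1.2.2 m h h2.2.1

open Classical in
/-- Decomposition of the escape event of `x` according to the last visit to a finite set
containing `x`. -/
lemma walk_noReturn_eq_sum (hprob : ∀ x, IsProbabilityMeasure (P x))
    (hP : ∀ (x : V) (n : ℕ) (c : ℕ → V), P x {w | ∀ i ≤ n, w i = c i} =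
      (if c 0 = x then 1 else 0) * ∏ i ∈ Finset.range n, p (c i) (c (i + 1)))
    (htrans : ∀ x y : V, ∀ᵐ w ∂P x, {n : ℕ | w n = y}.Finite)
    (L : Finset V) (x : V) (hx : x ∈ L) :
    P x (noReturn {x}) = ∑ y ∈ L, ∑' n,
      P x (pathPrefix n ⁻¹' escapePaths x y n) * P y (noReturn (L : Set V)) := by
  have hmem (y : V) (n : ℕ) (w : ℕ → V) : w ∈ pathPrefix n ⁻¹' escapePaths x y n ∩
      shiftPath n ⁻¹' noReturn (L : Set V) ↔
      w 0 = x ∧ w n = y ∧ (∀ i, 1 ≤ i → i ≤ n → w i ≠ x) ∧ ∀ i, n < i → w i ∉ L := by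
    simp only [escapePaths, pathPrefix, noReturn, shiftPath, Set.mem_inter_iff, Set.mem_preimage,
      Set.mem_ofPred_eq, Fin.val_zero, Fin.val_last, Finset.mem_coe, and_assoc]
    refine and_congr_right fun _ => and_congr_right fun _ => and_congr ?_ ?_
    · constructor
      · intro h i h1 hi
        exact h ⟨i, by omega⟩ (by simp [Fin.ext_iff]; omega)
      · intro h i hi
        exact h i (Fin.pos_iff_ne_zero.2 hi) (by omega)
    · constructor
      · intro h i hi
        simpa [show n + (i - n) = i by omega] using h (i - n) (by omega)
      · intro h i hi
        exact h _ (by omega)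
  have hmeas (y : V) (n : ℕ) : MeasurableSet (pathPrefix n ⁻¹' escapePaths x y n ∩
      shiftPath n ⁻¹' noReturn (L : Set V)) :=
    (measurableSet_pathPrefix_preimage n _).inter
      (measurable_shiftPath n (measurableSet_noReturn _))
  have hlast {y z : V} {n m : ℕ} {w : ℕ → V} (hy : y ∈ L) (hz : z ∈ L)
      (h1 : w ∈ pathPrefix n ⁻¹' escapePaths x y n ∩ shiftPath n ⁻¹' noReturn (L : Set V))
      (h2 : w ∈ pathPrefix m ⁻¹' escapePaths x z m ∩ shiftPath m ⁻¹' noReturn (L : Set V)) :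
      n = m := by
    rw [hmem] at h1 h2
    rcases lt_trichotomy n m with h | h | h
    · exact absurd (h2.2.1 ▸ hz) (h1.2.2.2 m h)
    · exact h
    · exact absurd (h1.2.1 ▸ hy) (h2.2.2.2 n h)
  have hmarkov (y : V) (n : ℕ) : P x (pathPrefix n ⁻¹' escapePaths x y n) *
      P y (noReturn (L : Set V)) = P x (pathPrefix n ⁻¹' escapePaths x y n ∩
        shiftPath n ⁻¹' noReturn (L : Set V)) :=
    (walk_markov hprob hP x y n _ (fun c hc => hc.2.1) (measurableSet_noReturn _)).symm
  simp_rw [hmarkov]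
  have hsum (y : V) (hy : y ∈ L) := measure_iUnion (μ := P x)
    (fun n m hnm => Set.disjoint_left.2 fun w h1 h2 => hnm (hlast hy hy h1 h2)) (hmeas y)
  rw [← Finset.sum_congr rfl hsum, ← measure_biUnion_finset]
  · refine measure_congr ?_
    have hfin : ∀ᵐ w ∂P x, ∀ y, {n : ℕ | w n = y}.Finite := ae_all_iff.2 (htrans x)
    filter_upwards [walk_ae_start hprob hP x, hfin] with w hw hfin
    refine propext (?_ : w ∈ noReturn {x} ↔ w ∈ ⋃ y ∈ L, ⋃ n,
      pathPrefix n ⁻¹' escapePaths x y n ∩ shiftPath n ⁻¹' noReturn (L : Set V))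
    simp only [Set.mem_iUnion, hmem, exists_prop]
    constructor
    · intro h
      have hL : {n | w n ∈ L}.Finite :=
        (L.finite_toSet.biUnion fun y _ => hfin y).subset fun n hn => by simpa using hn
      have hne : {n | w n ∈ L}.Nonempty := ⟨0, by simpa [hw] using hx⟩
      obtain ⟨n, hn, hmax⟩ := hL.exists_maximal hne
      refine ⟨w n, hn, n, hw, rfl, fun i hi _ => h i hi, fun i hi hiL => ?_⟩
      exact absurd (hmax hiL hi.le) (by omega)
    · rintro ⟨y, -, n, -, -, h1, h2⟩ i hi
      rcases le_or_gt i n with hin | hin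
      · exact h1 i hi hin
      · intro h
        exact h2 i hin (by rw [Set.mem_singleton_iff.1 h]; exact hx)
  · intro y hy z hz hyz
    refine Set.disjoint_left.2 fun w h1 h2 => hyz ?_
    obtain ⟨n, h1⟩ := Set.mem_iUnion.1 h1
    obtain ⟨m, h2⟩ := Set.mem_iUnion.1 h2
    obtain rfl := hlast hy hz h1 h2
    rw [hmem] at h1 h2
    exact h1.2.1.symm.trans h2.2.1
  · exact fun y _ => MeasurableSet.iUnion (hmeas y)

open Classical in
/-- The hitting identity for a walk that is reversible with respect to `A`. -/
lemma walk_sum_noReturn_mul_hits (hprob : ∀ x, IsProbabilityMeasure (P x))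
    (hP : ∀ (x : V) (n : ℕ) (c : ℕ → V), P x {w | ∀ i ≤ n, w i = c i} =
      (if c 0 = x then 1 else 0) * ∏ i ∈ Finset.range n, p (c i) (c (i + 1)))
    (htrans : ∀ x y : V, ∀ᵐ w ∂P x, {n : ℕ | w n = y}.Finite)
    (A : V → ℝ≥0∞) (hrev : ∀ u v, A u * p u v = A v * p v u)
    (L : Finset V) (x : V) (hx : x ∈ L) :
    ∑ y ∈ L, A y * P y (noReturn (L : Set V)) * P y (hits {x}) = A x * P x (noReturn {x}) := by
  rw [walk_noReturn_eq_sum hprob hP htrans L x hx, Finset.mul_sum]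
  refine Finset.sum_congr rfl fun y _ => ?_
  rw [walk_hits_eq_tsum hprob hP, mul_right_comm, ← ENNReal.tsum_mul_left,
    ENNReal.tsum_mul_right, ← mul_assoc, ← ENNReal.tsum_mul_left]
  simp_rw [walk_reverse hP A hrev]

end Walk

section Conductances

variable {V : Type*} (G : SimpleGraph V) [G.LocallyFinite] (a : V → V → ℝ)

lemma aTot_nonneg (hpos : ∀ x y, G.Adj x y → 0 < a x y) (x : V) : 0 ≤ aTot G a x :=
  Finset.sum_nonneg fun z hz => (hpos x z ((G.mem_neighborFinset x z).1 hz)).le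

lemma aTot_mul_step (hpos : ∀ x y, G.Adj x y → 0 < a x y) {x y : V} (h : G.Adj x y) :
    aTot G a x * step G a x y = a x y := by
  have : 0 < aTot G a x :=
    Finset.sum_pos (fun z hz => hpos x z ((G.mem_neighborFinset x z).1 hz))
      ⟨y, (G.mem_neighborFinset x y).2 h⟩
  rw [step, if_pos h, mul_div_cancel₀ _ this.ne']

lemma aTot_mul_step_comm (hsymm : ∀ x y, a x y = a y x)
    (hpos : ∀ x y, G.Adj x y → 0 < a x y) (x y : V) :
    aTot G a x * step G a x y = aTot G a y * step G a y x := by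
  by_cases h : G.Adj x y
  · rw [aTot_mul_step G a hpos h, aTot_mul_step G a hpos h.symm, hsymm]
  · simp [step, h, G.adj_comm y x]

end Conductances

open ProbabilityTheory in
open Classical in
/-- For every finite vertex set `L` and every `x ∈ L`:
`Σ_{x'∈L} e_L(x') · P_{x'}[τ_{{x}} < ∞] = cap({x})`. -/
theorem equil_hitting_singleton_capacity
    {V : Type*} [Countable V] [MeasurableSpace V] [DiscreteMeasurableSpace V]
    (G : SimpleGraph V) [G.LocallyFinite] (hconn : G.Connected)
    (a : V → V → ℝ)
    (hsymm : ∀ x y, a x y = a y x)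
    (hpos : ∀ x y, G.Adj x y → 0 < a x y)
    (P : V → Measure (ℕ → V)) (hprob : ∀ x, IsProbabilityMeasure (P x))
    (hP : ∀ (x : V) (n : ℕ) (c : ℕ → V),
      P x {w | ∀ i ≤ n, w i = c i} =
        (if c 0 = x then 1 else 0) *
          ∏ i ∈ Finset.range n, ENNReal.ofReal (step G a (c i) (c (i + 1))))
    (htrans : ∀ x y : V, ∀ᵐ w ∂ P x, {n : ℕ | w n = y}.Finite)
    (L : Finset V) (x : V) (hx : x ∈ L) :
    ∑ x' ∈ L, equil G a P L x' * ((P x') (hits ({x} : Set V))).toReal =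
      capa G a P {x} := by
  have h := walk_sum_noReturn_mul_hits hprob hP htrans
    (fun y => ENNReal.ofReal (aTot G a y)) (fun u v => by
      rw [← ENNReal.ofReal_mul (aTot_nonneg G a hpos u),
        ← ENNReal.ofReal_mul (aTot_nonneg G a hpos v), aTot_mul_step_comm G a hsymm hpos]) L x hx
  have h := congrArg ENNReal.toReal h
  rw [ENNReal.toReal_sum fun y _ => by finiteness] at h
  simp only [ENNReal.toReal_mul, ENNReal.toReal_ofReal (aTot_nonneg G a hpos _)] at h
  rw [capa, Finset.sum_singleton, equil, if_pos (Finset.mem_singleton_self x),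
    Finset.coe_singleton, ← h]
  exact Finset.sum_congr rfl fun y hy => by rw [equil, if_pos hy]
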